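/- Let k > 1/2 be real, x ∈ (0,1) and t > 0. With q_s(x,y) = ∑_{n=0}^∞ e^{−λ_n s}·G_n^{(k)}(cos(πx))·G_n^{(k)}(cos(πy))·ω_n^{(k)}·(sin(πy))^{2k}, the double integral ∫_0^t ∫_0^1 (sin(πy))^{−2}·q_s(x,y) dy ds is finite and equals (Γ(k−1/2)/(√π·Γ(k))) · ( t·ω_0^{(k)} + ∑_{n=1}^∞ (1/λ_{2n})·(1−e^{−λ_{2n} t})·ω_{2n}^{(k)}·G_{2n}^{(k)}(cos(πx)) ), the series on the right being absolutely convergent. -/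

import Mathlib

open Real MeasureTheory

/-- The Gegenbauer polynomial `G_n^{(k)}` as a function of a real variable. -/
noncomputable def gegenbauer (k : ℝ) (n : ℕ) (y : ℝ) : ℝ :=
  (1 / Real.Gamma k) *
    ∑ m ∈ Finset.range (n / 2 + 1),
      (-1 : ℝ) ^ m * Real.Gamma (k + n - m) /
          ((m.factorial : ℝ) * ((n - 2 * m).factorial : ℝ)) * (2 * y) ^ (n - 2 * m)

/-- The eigenvalue `λ_n = (π²/2) n (n + 2k)`. -/
noncomputable def lambdaAff (k : ℝ) (n : ℕ) : ℝ :=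
  Real.pi ^ 2 / 2 * n * (n + 2 * k)

/-- The normalization constant `ω_n^{(k)}`. -/
noncomputable def omegaAff (k : ℝ) (n : ℕ) : ℝ :=
  (n.factorial : ℝ) * (k + n) * Real.Gamma k ^ 2 /
    ((2 : ℝ) ^ (1 - 2 * k) * Real.Gamma (n + 2 * k))

/-- The transition density of the radial affine Dunkl process. -/
noncomputable def qDensity (k s x y : ℝ) : ℝ :=
  ∑' n : ℕ,
    Real.exp (-(lambdaAff k n) * s) * gegenbauer k n (Real.cos (Real.pi * x)) *
      gegenbauer k n (Real.cos (Real.pi * y)) * omegaAff k n *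
        Real.sin (Real.pi * y) ^ (2 * k)

namespace Gegenbauer

/-- The `m`-th summand of the Gegenbauer polynomial, extended by zero. -/
noncomputable def term (k : ℝ) (n m : ℕ) (y : ℝ) : ℝ :=
  if 2 * m ≤ n then
    (-1 : ℝ) ^ m * Real.Gamma (k + n - m) /
      ((m.factorial : ℝ) * ((n - 2 * m).factorial : ℝ)) * (2 * y) ^ (n - 2 * m)
  else 0

lemma eq_sum_term (k : ℝ) (n N : ℕ) (hN : n < 2 * N) (y : ℝ) :
    gegenbauer k n y = (1 / Real.Gamma k) * ∑ m ∈ Finset.range N, term k n m y := by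
  unfold gegenbauer
  congr 1
  rw [← Finset.sum_subset (s₁ := Finset.range (n / 2 + 1)) (s₂ := Finset.range N)]
  · refine Finset.sum_congr rfl fun m hm => ?_
    rw [Finset.mem_range] at hm
    rw [term, if_pos (by omega)]
  · intro m hm
    rw [Finset.mem_range] at hm ⊢
    omega
  · intro m _ hm
    rw [Finset.mem_range] at hm
    rw [term, if_neg (by omega)]

lemma term_add (k y : ℝ) (m j : ℕ) :
    term k (2 * m + j) m y = (-1 : ℝ) ^ m * Real.Gamma (k + m + j) /
      ((m.factorial : ℝ) * (j.factorial : ℝ)) * (2 * y) ^ j := by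
  rw [term, if_pos (by omega)]
  have h : 2 * m + j - 2 * m = j := by omega
  rw [h]
  congr 4
  push_cast
  ring

lemma term_of_lt (k y : ℝ) {n m : ℕ} (h : n < 2 * m) : term k n m y = 0 :=
  if_neg (by omega)

lemma term_zero_recurrence {k : ℝ} (hk : 0 < k) (n : ℕ) (y : ℝ) :
    (n + 2) * term k (n + 2) 0 y = 2 * (n + 1 + k) * y * term k (n + 1) 0 y := by
  have h1 := term_add k y 0 (n + 2)
  have h2 := term_add k y 0 (n + 1)
  simp only [mul_zero, zero_add] at h1 h2
  rw [h1, h2]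
  have hg : Real.Gamma (k + (0 : ℕ) + (n + 2 : ℕ)) =
      (k + n + 1) * Real.Gamma (k + (0 : ℕ) + (n + 1 : ℕ)) := by
    have := Real.Gamma_add_one (s := k + n + 1) (by positivity)
    push_cast
    rw [add_zero, ← add_assoc, ← add_assoc, ← this]
    congr 1; ring
  rw [hg, Nat.factorial_succ (n + 1)]
  push_cast
  field_simp
  ring

lemma term_succ_recurrence {k : ℝ} (hk : 0 < k) (n m : ℕ) (y : ℝ) :
    (n + 2) * term k (n + 2) (m + 1) y =
      2 * (n + 1 + k) * y * term k (n + 1) (m + 1) y - (n + 2 * k) * term k n m y := by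
  rcases lt_trichotomy n (2 * m) with h | h | h
  · rw [term_of_lt _ _ (by omega), term_of_lt _ _ (by omega), term_of_lt _ _ h]
    ring
  · have h1 := term_add k y (m + 1) 0
    have h2 := term_add k y m 0
    rw [show 2 * (m + 1) + 0 = n + 2 by omega] at h1
    rw [show 2 * m + 0 = n by omega] at h2
    rw [term_of_lt _ _ (show n + 1 < 2 * (m + 1) by omega), h1, h2]
    have hn : (n : ℝ) = 2 * m := by exact_mod_cast h
    have hg : Real.Gamma (k + (m + 1 : ℕ) + (0 : ℕ)) = (k + m) * Real.Gamma (k + m + (0 : ℕ)) := by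
      have := Real.Gamma_add_one (s := k + m) (by positivity)
      push_cast
      rw [add_zero, add_zero, ← this]
      congr 1; ring
    rw [hg, Nat.factorial_succ m, hn]
    push_cast
    field_simp
    ring
  · obtain ⟨j, rfl⟩ := Nat.exists_eq_add_of_le (show 2 * m + 1 ≤ n by omega)
    have h1 := term_add k y (m + 1) (j + 1)
    have h2 := term_add k y (m + 1) j
    have h3 := term_add k y m (j + 1)
    rw [show 2 * (m + 1) + (j + 1) = 2 * m + 1 + j + 2 by omega] at h1
    rw [show 2 * (m + 1) + j = 2 * m + 1 + j + 1 by omega] at h2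
    rw [show 2 * m + (j + 1) = 2 * m + 1 + j by omega] at h3
    rw [h1, h2, h3]
    have hg : Real.Gamma (k + (m + 1 : ℕ) + (j + 1 : ℕ)) =
        (k + m + j + 1) * Real.Gamma (k + m + j + 1) := by
      rw [← Real.Gamma_add_one (by positivity)]
      congr 1; push_cast; ring
    have hg' : Real.Gamma (k + (m + 1 : ℕ) + j) = Real.Gamma (k + m + j + 1) := by
      congr 1; push_cast; ring
    have hg'' : Real.Gamma (k + m + (j + 1 : ℕ)) = Real.Gamma (k + m + j + 1) := by
      congr 1; push_cast; ring
    rw [hg, hg', hg'', Nat.factorial_succ m, Nat.factorial_succ j]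
    push_cast
    field_simp
    ring

lemma recurrence {k : ℝ} (hk : 0 < k) (n : ℕ) (y : ℝ) :
    (n + 2) * gegenbauer k (n + 2) y =
      2 * (n + 1 + k) * y * gegenbauer k (n + 1) y - (n + 2 * k) * gegenbauer k n y := by
  rw [eq_sum_term k (n + 2) (n + 3) (by omega), eq_sum_term k (n + 1) (n + 3) (by omega),
    eq_sum_term k n (n + 2) (by omega), Finset.sum_range_succ',
    Finset.sum_range_succ' (term k (n + 1) · y)]
  have h : (n + 2) * ∑ m ∈ Finset.range (n + 2), term k (n + 2) (m + 1) y =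
      2 * (n + 1 + k) * y * ∑ m ∈ Finset.range (n + 2), term k (n + 1) (m + 1) y -
        (n + 2 * k) * ∑ m ∈ Finset.range (n + 2), term k n m y := by
    simp only [Finset.mul_sum, ← Finset.sum_sub_distrib, term_succ_recurrence hk]
  have h0 := term_zero_recurrence hk n y
  linear_combination (1 / Real.Gamma k) * (h + h0)

lemma zero_eq {k : ℝ} (hk : 0 < k) (y : ℝ) : gegenbauer k 0 y = 1 := by
  have := (Real.Gamma_pos_of_pos hk).ne'
  simp [gegenbauer, this]

lemma one_eq {k : ℝ} (hk : 0 < k) (y : ℝ) : gegenbauer k 1 y = 2 * k * y := by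
  have := (Real.Gamma_pos_of_pos hk).ne'
  simp [gegenbauer, Real.Gamma_add_one hk.ne']
  field_simp

lemma contDiff (k : ℝ) (n : ℕ) : ContDiff ℝ 2 (gegenbauer k n) := by
  unfold gegenbauer
  fun_prop

lemma hasDerivAt (k : ℝ) (n : ℕ) (y : ℝ) :
    HasDerivAt (gegenbauer k n) (deriv (gegenbauer k n) y) y :=
  ((contDiff k n).differentiable (by norm_num) y).hasDerivAt

lemma hasDerivAt_deriv (k : ℝ) (n : ℕ) (y : ℝ) :
    HasDerivAt (deriv (gegenbauer k n)) (deriv (deriv (gegenbauer k n)) y) y :=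
  ((contDiff k n).differentiable_deriv_two y).hasDerivAt

lemma deriv_recurrence {k : ℝ} (hk : 0 < k) (n : ℕ) (y : ℝ) :
    (n + 2) * deriv (gegenbauer k (n + 2)) y =
      2 * (n + 1 + k) * (gegenbauer k (n + 1) y + y * deriv (gegenbauer k (n + 1)) y) -
        (n + 2 * k) * deriv (gegenbauer k n) y := by
  have h1 := (hasDerivAt k (n + 2) y).const_mul ((n : ℝ) + 2)
  have h2 := (((hasDerivAt_id y).const_mul (2 * ((n : ℝ) + 1 + k))).mul
    (hasDerivAt k (n + 1) y)).sub ((hasDerivAt k n y).const_mul ((n : ℝ) + 2 * k))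
  have h3 := h1.unique (h2.congr_of_eventuallyEq (.of_forall fun z => recurrence hk n z))
  simp only [id] at h3
  rw [h3]
  ring

/-- The two first-order relations between consecutive Gegenbauer polynomials. -/
lemma deriv_relations {k : ℝ} (hk : 0 < k) (n : ℕ) (y : ℝ) :
    y * deriv (gegenbauer k (n + 1)) y - deriv (gegenbauer k n) y =
        (n + 1) * gegenbauer k (n + 1) y ∧
      deriv (gegenbauer k (n + 1)) y - y * deriv (gegenbauer k n) y =
        (n + 2 * k) * gegenbauer k n y := by
  induction n with
  | zero =>
    have h0 : gegenbauer k 0 = fun _ => 1 := funext (zero_eq hk)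
    have h1 : gegenbauer k 1 = fun y => 2 * k * y := funext (one_eq hk)
    simp only [zero_add, h0, h1, deriv_const]
    constructor
    · simp
      ring
    · simp
  | succ n ih =>
    obtain ⟨hb, hc⟩ := ih
    have hd := deriv_recurrence hk n y
    have hr := recurrence hk n y
    have hn : (n : ℝ) + 2 ≠ 0 := by positivity
    have hc' : deriv (gegenbauer k (n + 2)) y - y * deriv (gegenbauer k (n + 1)) y =
        (n + 1 + 2 * k) * gegenbauer k (n + 1) y := by
      apply mul_left_cancel₀ hn
      linear_combination hd + (n + 2 * k) * hb
    push_cast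
    refine ⟨?_, hc'⟩
    rw [show n + 1 + 1 = n + 2 by rfl]
    linear_combination y * hc' - hr + y * hb - hc

lemma one_sub_sq_mul_deriv {k : ℝ} (hk : 0 < k) (n : ℕ) (y : ℝ) :
    (1 - y ^ 2) * deriv (gegenbauer k n) y =
      (n + 2 * k) * y * gegenbauer k n y - (n + 1) * gegenbauer k (n + 1) y := by
  obtain ⟨hb, hc⟩ := deriv_relations hk n y
  linear_combination y * hc - hb

/-- The Gegenbauer differential equation. -/
lemma differential_equation {k : ℝ} (hk : 0 < k) (n : ℕ) (y : ℝ) :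
    (1 - y ^ 2) * deriv (deriv (gegenbauer k n)) y =
      (2 * k + 1) * y * deriv (gegenbauer k n) y - n * (n + 2 * k) * gegenbauer k n y := by
  have h1 := ((((hasDerivAt_id y).pow 2).const_sub 1).mul (hasDerivAt_deriv k n y))
  have h2 := ((((hasDerivAt_id y).const_mul ((n : ℝ) + 2 * k)).mul
    (hasDerivAt k n y)).sub ((hasDerivAt k (n + 1) y).const_mul ((n : ℝ) + 1)))
  have h3 := h1.unique (h2.congr_of_eventuallyEq
    (.of_forall fun z => by simpa using one_sub_sq_mul_deriv hk n z))
  simp only [id] at h3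
  obtain ⟨hb, hc⟩ := deriv_relations hk n y
  simp at h3
  linear_combination h3 - (n + 1) * hc

lemma neg_eq {k : ℝ} (hk : 0 < k) (n : ℕ) (y : ℝ) :
    gegenbauer k n (-y) = (-1) ^ n * gegenbauer k n y := by
  induction n using Nat.twoStepInduction with
  | zero => simp [zero_eq hk]
  | one => simp [one_eq hk]
  | more n h0 h1 =>
    have hn : (n : ℝ) + 2 ≠ 0 := by positivity
    apply mul_left_cancel₀ hn
    rw [recurrence hk, h0, h1]
    linear_combination (-(-1) ^ n) * recurrence hk n y

lemma eval_one {k : ℝ} (hk : 0 < k) (n : ℕ) :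
    gegenbauer k n 1 = Real.Gamma (n + 2 * k) / (Real.Gamma (2 * k) * n.factorial) := by
  have hg := (Real.Gamma_pos_of_pos (show 0 < 2 * k by positivity)).ne'
  induction n using Nat.twoStepInduction with
  | zero => simp [zero_eq hk, hg]
  | one =>
    rw [one_eq hk, Nat.cast_one, add_comm, Real.Gamma_add_one (by positivity)]
    simp
    field_simp
  | more n h0 h1 =>
    have hn : (n : ℝ) + 2 ≠ 0 := by positivity
    have e1 : Real.Gamma ((n + 1 : ℕ) + 2 * k) = (n + 2 * k) * Real.Gamma (n + 2 * k) := by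
      rw [← Real.Gamma_add_one (by positivity)]
      congr 1; push_cast; ring
    have e2 : Real.Gamma ((n + 2 : ℕ) + 2 * k) =
        (n + 1 + 2 * k) * ((n + 2 * k) * Real.Gamma (n + 2 * k)) := by
      rw [← Real.Gamma_add_one (s := n + 2 * k) (by positivity),
        show (n + 1 + 2 * k : ℝ) = n + 2 * k + 1 by ring, ← Real.Gamma_add_one (by positivity)]
      congr 1; push_cast; ring
    apply mul_left_cancel₀ hn
    rw [recurrence hk, h0, h1, e1, e2, Nat.factorial_succ (n + 1), Nat.factorial_succ n]
    push_cast
    field_simp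
    ring

lemma eval_zero_recurrence {k : ℝ} (hk : 0 < k) (n : ℕ) :
    (n + 2) * gegenbauer k (n + 2) 0 = -(n + 2 * k) * gegenbauer k n 0 := by
  rw [recurrence hk]
  ring

lemma eval_zero_odd {k : ℝ} (hk : 0 < k) (m : ℕ) : gegenbauer k (2 * m + 1) 0 = 0 := by
  have := neg_eq hk (2 * m + 1) 0
  rw [neg_zero, pow_succ, pow_mul] at this
  norm_num at this
  linarith

lemma eval_zero_even {k : ℝ} (hk : 0 < k) (m : ℕ) :
    gegenbauer k (2 * m) 0 = (-1) ^ m * (Real.Gamma (m + k) / (Real.Gamma k * m.factorial)) := by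
  have hg := (Real.Gamma_pos_of_pos hk).ne'
  induction m with
  | zero => simp [zero_eq hk, hg]
  | succ m ih =>
    have hn : ((2 * m : ℕ) : ℝ) + 2 ≠ 0 := by positivity
    have e1 : Real.Gamma ((m + 1 : ℕ) + k) = (m + k) * Real.Gamma (m + k) := by
      rw [← Real.Gamma_add_one (by positivity)]
      congr 1; push_cast; ring
    apply mul_left_cancel₀ hn
    rw [show 2 * (m + 1) = 2 * m + 2 by ring, eval_zero_recurrence hk, ih, e1,
      Nat.factorial_succ m]
    push_cast
    field_simp
    ring

/-- The Sonin energy of the Gegenbauer differential equation. -/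
noncomputable def energy (k : ℝ) (n : ℕ) (y : ℝ) : ℝ :=
  n * (n + 2 * k) * gegenbauer k n y ^ 2 + (1 - y ^ 2) * deriv (gegenbauer k n) y ^ 2

lemma hasDerivAt_energy {k : ℝ} (hk : 0 < k) (n : ℕ) (y : ℝ) :
    HasDerivAt (energy k n) (4 * k * y * deriv (gegenbauer k n) y ^ 2) y := by
  have h := (((hasDerivAt k n y).pow 2).const_mul ((n : ℝ) * (n + 2 * k))).add
    ((((hasDerivAt_id y).pow 2).const_sub 1).mul ((hasDerivAt_deriv k n y).pow 2))
  refine h.congr_deriv ?_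
  have hd := differential_equation hk n y
  simp
  linear_combination 2 * deriv (gegenbauer k n) y * hd

lemma monotoneOn_energy {k : ℝ} (hk : 0 < k) (n : ℕ) :
    MonotoneOn (energy k n) (Set.Icc 0 1) := by
  refine monotoneOn_of_deriv_nonneg (convex_Icc 0 1)
    (fun y _ => (hasDerivAt_energy hk n y).continuousAt.continuousWithinAt)
    (fun y _ => (hasDerivAt_energy hk n y).differentiableAt.differentiableWithinAt) ?_
  intro y hy
  rw [interior_Icc] at hy
  have := hy.1
  rw [(hasDerivAt_energy hk n y).deriv]
  positivity

lemma antitoneOn_weighted_energy {k : ℝ} (hk : 0 < k) (n : ℕ) :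
    AntitoneOn (fun y => (1 - y ^ 2) ^ (2 * k) * energy k n y) (Set.Ico 0 1) := by
  have hd : ∀ y ∈ Set.Ico (0 : ℝ) 1, HasDerivAt (fun y => (1 - y ^ 2) ^ (2 * k) * energy k n y)
      (-(4 * k * y * (n * (n + 2 * k)) * (1 - y ^ 2) ^ (2 * k - 1) * gegenbauer k n y ^ 2)) y := by
    intro y hy
    have hy2 : 0 < 1 - y ^ 2 := by nlinarith [hy.1, hy.2]
    have h1 : HasDerivAt (fun y : ℝ => 1 - y ^ 2) (-(2 * y)) y := by
      simpa using ((hasDerivAt_id y).pow 2).const_sub 1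
    refine ((h1.rpow_const (p := 2 * k) (.inl hy2.ne')).mul
      (hasDerivAt_energy hk n y)).congr_deriv ?_
    have hp : (1 - y ^ 2) ^ (2 * k) = (1 - y ^ 2) ^ (2 * k - 1) * (1 - y ^ 2) := by
      rw [Real.rpow_sub_one hy2.ne', div_mul_cancel₀ _ hy2.ne']
    simp only [hp, energy]
    ring
  refine antitoneOn_of_deriv_nonpos (convex_Ico 0 1)
    (fun y hy => (hd y hy).continuousAt.continuousWithinAt) ?_ ?_
  · intro y hy
    exact (hd y (interior_subset hy)).differentiableAt.differentiableWithinAt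
  · intro y hy
    have hy := interior_subset hy
    have hy2 : 0 < 1 - y ^ 2 := by nlinarith [hy.1, hy.2]
    have := hy.1
    rw [(hd y hy).deriv]
    exact neg_nonpos.mpr (by positivity)

lemma abs_eval_abs {k : ℝ} (hk : 0 < k) (n : ℕ) (y : ℝ) :
    |gegenbauer k n (abs y)| = |gegenbauer k n y| := by
  rcases abs_cases y with ⟨h, _⟩ | ⟨h, _⟩ <;> rw [h]
  rw [neg_eq hk, abs_mul, abs_pow, abs_neg, abs_one, one_pow, one_mul]

lemma abs_le_eval_one {k : ℝ} (hk : 0 < k) (n : ℕ) {y : ℝ} (hy : |y| ≤ 1) :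
    |gegenbauer k n y| ≤ gegenbauer k n 1 := by
  rcases Nat.eq_zero_or_pos n with rfl | hn
  · simp [zero_eq hk]
  have h1 : 0 ≤ gegenbauer k n 1 := by
    rw [eval_one hk]
    have := Real.Gamma_pos_of_pos (show 0 < n + 2 * k by positivity)
    have := Real.Gamma_pos_of_pos (show 0 < 2 * k by positivity)
    positivity
  rw [← abs_eval_abs hk]
  refine abs_le_of_sq_le_sq ?_ h1
  have h := monotoneOn_energy hk n ⟨abs_nonneg y, hy⟩ (Set.right_mem_Icc.mpr zero_le_one) hy
  have h2 : 0 ≤ (1 - |y| ^ 2) * deriv (gegenbauer k n) |y| ^ 2 :=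
    mul_nonneg (by nlinarith [abs_nonneg y]) (sq_nonneg _)
  simp only [energy] at h
  have hn' : (0 : ℝ) < n * (n + 2 * k) := by positivity
  refine le_of_mul_le_mul_left ?_ hn'
  linarith

lemma sq_le_energy_zero {k : ℝ} (hk : 0 < k) (n : ℕ) {y : ℝ} (hy : |y| < 1) :
    n * (n + 2 * k) * gegenbauer k n y ^ 2 ≤ energy k n 0 * (1 - y ^ 2) ^ (-(2 * k)) := by
  have h := antitoneOn_weighted_energy hk n (Set.left_mem_Ico.mpr zero_lt_one)
    ⟨abs_nonneg y, hy⟩ (abs_nonneg y)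
  have hy2 : 0 < 1 - y ^ 2 := by rw [← sq_abs]; nlinarith [abs_nonneg y]
  have hp := Real.rpow_pos_of_pos hy2 (2 * k)
  have h2 : 0 ≤ (1 - |y| ^ 2) * deriv (gegenbauer k n) |y| ^ 2 :=
    mul_nonneg (by rw [sq_abs]; exact hy2.le) (sq_nonneg _)
  rw [Real.rpow_neg hy2.le, ← div_eq_mul_inv, le_div_iff₀ hp]
  rw [← sq_abs (gegenbauer k n y), ← abs_eval_abs hk, sq_abs]
  have h3 : n * (n + 2 * k) * gegenbauer k n (abs y) ^ 2 ≤ energy k n (abs y) := by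
    rw [energy]
    linarith
  simp only [sq_abs] at h
  norm_num at h
  nlinarith

/-- The energy at the origin in terms of two consecutive values at the origin. -/
lemma energy_succ_zero {k : ℝ} (hk : 0 < k) (n : ℕ) :
    energy k (n + 1) 0 = (n + 1) * (n + 1 + 2 * k) * gegenbauer k (n + 1) 0 ^ 2 +
      (n + 2 * k) ^ 2 * gegenbauer k n 0 ^ 2 := by
  have h := (deriv_relations hk n 0).2
  have h' : deriv (gegenbauer k (n + 1)) 0 = (n + 2 * k) * gegenbauer k n 0 := by linarith
  rw [energy, h']
  push_cast
  ring

end Gegenbauer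

section Asymptotics

open Filter Topology Asymptotics

lemma tendsto_Gamma_nat_add_div {a : ℝ} (ha : 0 < a) :
    Tendsto (fun n : ℕ => Real.Gamma (n + a) / (n.factorial * (n : ℝ) ^ (a - 1))) atTop (𝓝 1) := by
  have hg := (Real.Gamma_pos_of_pos ha).ne'
  have hprod : ∀ n : ℕ, ∏ j ∈ Finset.range n, (a + j) = Real.Gamma (n + a) / Real.Gamma a := by
    intro n
    induction n with
    | zero => simp [hg]
    | succ n ih =>
      rw [Finset.prod_range_succ, ih]
      have := Real.Gamma_add_one (s := n + a) (by positivity)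
      rw [show ((n + 1 : ℕ) : ℝ) + a = n + a + 1 by push_cast; ring, this]
      ring
  have h1 := (Real.GammaSeq_tendsto_Gamma a).inv₀ hg
  have h2 : Tendsto (fun n : ℕ => (n : ℝ) / (n + a)) atTop (𝓝 1) :=
    tendsto_natCast_div_add_atTop a
  have h3 := ((h1.mul_const (Real.Gamma a)).mul h2)
  rw [inv_mul_cancel₀ hg, one_mul] at h3
  refine h3.congr' ?_
  filter_upwards [eventually_gt_atTop 0] with n hn
  have hn' : (0 : ℝ) < n := by exact_mod_cast hn
  have hp := Real.rpow_pos_of_pos hn' a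
  have hG := Real.Gamma_pos_of_pos (show 0 < n + a by positivity)
  rw [Real.GammaSeq, Finset.prod_range_succ, hprod, Real.rpow_sub_one hn'.ne']
  field_simp
  ring

lemma isTheta_Gamma_nat_add {a : ℝ} (ha : 0 < a) :
    (fun n : ℕ => Real.Gamma (n + a) / n.factorial) =Θ[atTop] fun n : ℕ => (n : ℝ) ^ (a - 1) := by
  have h : (fun n : ℕ => Real.Gamma (n + a) / n.factorial) ~[atTop]
      fun n : ℕ => (n : ℝ) ^ (a - 1) := by
    refine isEquivalent_of_tendsto_one ?_
    refine (tendsto_Gamma_nat_add_div ha).congr fun n => ?_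
    simp only [Pi.div_apply, div_div]
  exact h.isTheta

lemma exists_bounds_Gamma_nat_add {a : ℝ} (ha : 0 < a) :
    ∃ C : ℝ, 0 < C ∧ ∀ n : ℕ, 0 < n →
      Real.Gamma (n + a) / n.factorial ≤ C * (n : ℝ) ^ (a - 1) ∧
        (n : ℝ) ^ (a - 1) ≤ C * (Real.Gamma (n + a) / n.factorial) := by
  have hG : ∀ n : ℕ, 0 < Real.Gamma (n + a) / n.factorial := fun n =>
    div_pos (Real.Gamma_pos_of_pos (by positivity)) (by positivity)
  obtain ⟨C₁, hC₁, h₁⟩ := bound_of_isBigO_nat_atTop (isTheta_Gamma_nat_add ha).isBigO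
  obtain ⟨C₂, hC₂, h₂⟩ := bound_of_isBigO_nat_atTop (isTheta_Gamma_nat_add ha).symm.isBigO
  refine ⟨max C₁ C₂, lt_max_of_lt_left hC₁, fun n hn => ?_⟩
  have hn' : (0 : ℝ) < n := by exact_mod_cast hn
  have hp := Real.rpow_pos_of_pos hn' (a - 1)
  have e₁ := h₁ hp.ne'
  have e₂ := h₂ (hG n).ne'
  rw [Real.norm_of_nonneg (hG n).le, Real.norm_of_nonneg hp.le] at e₁ e₂
  exact ⟨e₁.trans (by gcongr; exact le_max_left _ _),
    e₂.trans (by have := hG n; gcongr; exact le_max_right _ _)⟩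

namespace Gegenbauer

lemma exists_abs_eval_zero_le {k : ℝ} (hk : 0 < k) :
    ∃ C : ℝ, 0 < C ∧ ∀ n : ℕ, 0 < n → |gegenbauer k n 0| ≤ C * (n : ℝ) ^ (k - 1) := by
  obtain ⟨C, hC, h⟩ := exists_bounds_Gamma_nat_add hk
  have hg := Real.Gamma_pos_of_pos hk
  refine ⟨C / (Real.Gamma k * 2 ^ (k - 1)), by positivity, fun n hn => ?_⟩
  rcases Nat.even_or_odd' n with ⟨m, rfl | rfl⟩
  · have hm := (h m (by omega)).1
    have hG := Real.Gamma_pos_of_pos (show 0 < m + k by positivity)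
    rw [eval_zero_even hk, abs_mul, abs_pow, abs_neg, abs_one, one_pow, one_mul,
      abs_of_pos (by positivity), mul_comm (Real.Gamma k), ← div_div]
    push_cast
    rw [Real.mul_rpow zero_le_two (Nat.cast_nonneg m)]
    calc _ ≤ C * (m : ℝ) ^ (k - 1) / Real.Gamma k := by gcongr
      _ = _ := by field_simp
  · rw [eval_zero_odd hk, abs_zero]
    positivity

lemma exists_energy_zero_le {k : ℝ} (hk : 0 < k) :
    ∃ C : ℝ, 0 < C ∧ ∀ n : ℕ, 0 < n → energy k n 0 ≤ C * (n : ℝ) ^ (2 * k) := by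
  obtain ⟨C, hC, h⟩ := exists_abs_eval_zero_le hk
  have hsq : ∀ n : ℕ, 0 < n → (n : ℝ) ^ 2 * gegenbauer k n 0 ^ 2 ≤ C ^ 2 * (n : ℝ) ^ (2 * k) := by
    intro n hn
    have hn' : (0 : ℝ) < n := by exact_mod_cast hn
    have := pow_le_pow_left₀ (abs_nonneg _) (h n hn) 2
    rw [sq_abs] at this
    calc (n : ℝ) ^ 2 * gegenbauer k n 0 ^ 2 ≤ (n : ℝ) ^ 2 * (C * (n : ℝ) ^ (k - 1)) ^ 2 := by gcongr
      _ = C ^ 2 * (n : ℝ) ^ (2 * k) := by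
        rw [Real.rpow_sub_one hn'.ne', two_mul, Real.rpow_add hn']
        field_simp
  refine ⟨max (energy k 1 0) (C ^ 2 * ((1 + 2 * k) + (1 + 2 * k) ^ 2)),
    lt_max_of_lt_right (by positivity), fun n hn => ?_⟩
  rcases (show n = 1 ∨ 1 < n by omega) with rfl | hn1
  · simp
  obtain ⟨m, rfl⟩ := Nat.exists_eq_add_of_lt hn1
  rw [show 1 + m + 1 = (m + 1) + 1 by ring, energy_succ_zero hk]
  have h1 := hsq (m + 1 + 1) (by omega)
  have h2 := hsq (m + 1) (by omega)
  set N : ℝ := ((m + 1 + 1 : ℕ) : ℝ) with hN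
  have hMN : ((m + 1 : ℕ) : ℝ) ≤ N := by simp [hN]
  have hM1 : (1 : ℝ) ≤ ((m + 1 : ℕ) : ℝ) := by simp
  set M : ℝ := ((m + 1 : ℕ) : ℝ) with hM
  have hN1 : M + 1 = N := by simp [hM, hN]
  rw [hN1]
  have hpow : M ^ (2 * k) ≤ N ^ (2 * k) := Real.rpow_le_rpow (by linarith) hMN (by positivity)
  have b1 : N * (N + 2 * k) * gegenbauer k (m + 1 + 1) 0 ^ 2 ≤
      (1 + 2 * k) * (C ^ 2 * N ^ (2 * k)) := by
    calc _ ≤ ((1 + 2 * k) * N ^ 2) * gegenbauer k (m + 1 + 1) 0 ^ 2 :=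
          mul_le_mul_of_nonneg_right (by nlinarith [mul_nonneg hk.le (mul_nonneg
            (by linarith : 0 ≤ N) (by linarith : 0 ≤ N - 1))]) (sq_nonneg _)
      _ = (1 + 2 * k) * (N ^ 2 * gegenbauer k (m + 1 + 1) 0 ^ 2) := by ring
      _ ≤ _ := by gcongr
  have b2 : (M + 2 * k) ^ 2 * gegenbauer k (m + 1) 0 ^ 2 ≤
      (1 + 2 * k) ^ 2 * (C ^ 2 * N ^ (2 * k)) := by
    calc _ ≤ ((1 + 2 * k) * M) ^ 2 * gegenbauer k (m + 1) 0 ^ 2 := by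
          gcongr
          nlinarith
      _ = (1 + 2 * k) ^ 2 * (M ^ 2 * gegenbauer k (m + 1) 0 ^ 2) := by ring
      _ ≤ (1 + 2 * k) ^ 2 * (C ^ 2 * M ^ (2 * k)) := by gcongr
      _ ≤ _ := by gcongr
  calc _ ≤ (C ^ 2 * ((1 + 2 * k) + (1 + 2 * k) ^ 2)) * N ^ (2 * k) := by linarith
    _ ≤ _ := by
      gcongr
      exact le_max_right _ _

lemma exists_abs_le_weighted {k : ℝ} (hk : 0 < k) :
    ∃ C : ℝ, 0 < C ∧ ∀ n : ℕ, 0 < n → ∀ y : ℝ, |y| < 1 →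
      |gegenbauer k n y| ≤ C * ((n : ℝ) ^ (k - 1) * (1 - y ^ 2) ^ (-k)) := by
  obtain ⟨C, hC, h⟩ := exists_energy_zero_le hk
  refine ⟨√C, by positivity, fun n hn y hy => ?_⟩
  have hn' : (0 : ℝ) < n := by exact_mod_cast hn
  have hy2 : 0 < 1 - y ^ 2 := by rw [← sq_abs]; nlinarith [abs_nonneg y]
  have e := sq_le_energy_zero hk n hy
  refine abs_le_of_sq_le_sq ?_ (by positivity)
  have hn2 : (0 : ℝ) < n ^ 2 := by positivity
  refine le_of_mul_le_mul_left ?_ hn2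
  calc (n : ℝ) ^ 2 * gegenbauer k n y ^ 2 ≤ n * (n + 2 * k) * gegenbauer k n y ^ 2 := by
        gcongr
        nlinarith
    _ ≤ energy k n 0 * (1 - y ^ 2) ^ (-(2 * k)) := e
    _ ≤ C * (n : ℝ) ^ (2 * k) * (1 - y ^ 2) ^ (-(2 * k)) := by
        gcongr
        exact h n hn
    _ = _ := by
        rw [mul_pow, Real.sq_sqrt hC.le, Real.rpow_sub_one hn'.ne', show -(2 * k) = -k + -k by ring,
          two_mul, Real.rpow_add hn', Real.rpow_add hy2]
        field_simp

lemma exists_abs_le {k : ℝ} (hk : 0 < k) :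
    ∃ C : ℝ, 0 < C ∧ ∀ n : ℕ, 0 < n → ∀ y : ℝ, |y| ≤ 1 →
      |gegenbauer k n y| ≤ C * (n : ℝ) ^ (2 * k - 1) := by
  have hk2 : 0 < 2 * k := by positivity
  obtain ⟨C, hC, h⟩ := exists_bounds_Gamma_nat_add hk2
  have hg := Real.Gamma_pos_of_pos hk2
  refine ⟨C / Real.Gamma (2 * k), by positivity, fun n hn y hy => ?_⟩
  refine (abs_le_eval_one hk n hy).trans ?_
  rw [eval_one hk, mul_comm (Real.Gamma (2 * k)), ← div_div, div_mul_eq_mul_div]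
  gcongr
  exact (h n hn).1

/-- The geometric mean of the interior bound and the uniform bound. -/
lemma exists_abs_le_interpolated {k σ : ℝ} (hk : 0 < k) (hσ : 0 ≤ σ) (hσk : σ ≤ k) :
    ∃ C : ℝ, 0 < C ∧ ∀ n : ℕ, 0 < n → ∀ y : ℝ, |y| < 1 →
      |gegenbauer k n y| ≤ C * ((n : ℝ) ^ (k - 1 + σ) * (1 - y ^ 2) ^ (σ - k)) := by
  obtain ⟨C₁, hC₁, h₁⟩ := exists_abs_le_weighted hk
  obtain ⟨C₂, hC₂, h₂⟩ := exists_abs_le hk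
  have hτ0 : 0 ≤ σ / k := by positivity
  have hτ1 : 0 ≤ 1 - σ / k := by rw [sub_nonneg, div_le_one hk]; exact hσk
  refine ⟨C₁ ^ (1 - σ / k) * C₂ ^ (σ / k), by positivity, fun n hn y hy => ?_⟩
  have hn' : (0 : ℝ) < n := by exact_mod_cast hn
  have hy2 : 0 < 1 - y ^ 2 := by rw [← sq_abs]; nlinarith [abs_nonneg y]
  calc |gegenbauer k n y|
      = |gegenbauer k n y| ^ (1 - σ / k) * |gegenbauer k n y| ^ (σ / k) := by
        rw [← Real.rpow_add_of_nonneg (abs_nonneg _) hτ1 hτ0, sub_add_cancel, Real.rpow_one]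
    _ ≤ (C₁ * ((n : ℝ) ^ (k - 1) * (1 - y ^ 2) ^ (-k))) ^ (1 - σ / k) *
          (C₂ * (n : ℝ) ^ (2 * k - 1)) ^ (σ / k) := by
        gcongr
        · exact h₁ n hn y hy
        · exact h₂ n hn y hy.le
    _ = _ := by
        rw [Real.mul_rpow hC₁.le (by positivity), Real.mul_rpow (by positivity) (by positivity),
          Real.mul_rpow hC₂.le (by positivity), ← Real.rpow_mul hn'.le, ← Real.rpow_mul hn'.le,
          ← Real.rpow_mul hy2.le,
          show k - 1 + σ = (k - 1) * (1 - σ / k) + (2 * k - 1) * (σ / k) by field_simp; ring,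
          Real.rpow_add hn', show -k * (1 - σ / k) = σ - k by field_simp; ring]
        ring

end Gegenbauer

lemma omegaAff_pos {k : ℝ} (hk : 0 < k) (n : ℕ) : 0 < omegaAff k n := by
  have := Real.Gamma_pos_of_pos hk
  have := Real.Gamma_pos_of_pos (show 0 < n + 2 * k by positivity)
  unfold omegaAff
  positivity

lemma exists_omegaAff_le {k : ℝ} (hk : 0 < k) :
    ∃ C : ℝ, 0 < C ∧ ∀ n : ℕ, 0 < n → omegaAff k n ≤ C * (n : ℝ) ^ (2 - 2 * k) := by
  obtain ⟨C, hC, h⟩ := exists_bounds_Gamma_nat_add (show 0 < 2 * k by positivity)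
  have hg := Real.Gamma_pos_of_pos hk
  refine ⟨(k + 1) * Real.Gamma k ^ 2 / 2 ^ (1 - 2 * k) * C, by positivity, fun n hn => ?_⟩
  have hn' : (0 : ℝ) < n := by exact_mod_cast hn
  have hn1 : (1 : ℝ) ≤ n := by exact_mod_cast hn
  have hG := Real.Gamma_pos_of_pos (show 0 < n + 2 * k by positivity)
  have h2 : (n.factorial : ℝ) / Real.Gamma (n + 2 * k) ≤ C * (n : ℝ) ^ (1 - 2 * k) := by
    have := (h n hn).2
    rw [show 1 - 2 * k = -(2 * k - 1) by ring, Real.rpow_neg hn'.le, ← div_eq_mul_inv,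
      div_le_div_iff₀ hG (by positivity)]
    rw [← mul_div_assoc, le_div_iff₀ (by positivity)] at this
    linarith
  calc omegaAff k n = (k + n) * Real.Gamma k ^ 2 / 2 ^ (1 - 2 * k) *
        ((n.factorial : ℝ) / Real.Gamma (n + 2 * k)) := by
        rw [omegaAff]; field_simp
    _ ≤ ((k + 1) * n) * Real.Gamma k ^ 2 / 2 ^ (1 - 2 * k) * (C * (n : ℝ) ^ (1 - 2 * k)) := by
        gcongr
        nlinarith
    _ = _ := by
        rw [show 2 - 2 * k = 1 - 2 * k + 1 by ring, Real.rpow_add_one hn'.ne']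
        ring

lemma integrable_tsum_of_summable_integral_norm {α ι : Type*} [MeasurableSpace α] {μ : Measure α}
    [Countable ι] {F : ι → α → ℝ} (hF_int : ∀ i, Integrable (F i) μ)
    (hF_sum : Summable fun i => ∫ a, ‖F i a‖ ∂μ) : Integrable (fun a => ∑' i, F i a) μ := by
  refine ⟨(AEMeasurable.tsum fun i => (hF_int i).1.aemeasurable).aestronglyMeasurable, ?_⟩
  refine lt_of_le_of_lt (lintegral_mono fun a => enorm_tsum_le_tsum_enorm) ?_
  rw [lintegral_tsum fun i => (hF_int i).1.enorm]
  have (i : ι) : ∫⁻ a, ‖F i a‖ₑ ∂μ = ENNReal.ofReal (∫ a, ‖F i a‖ ∂μ) := by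
    rw [ofReal_integral_norm_eq_lintegral_enorm (hF_int i)]
  simp only [this]
  rw [← ENNReal.ofReal_tsum_of_nonneg (fun i => integral_nonneg fun a => norm_nonneg _) hF_sum]
  exact ENNReal.ofReal_lt_top

lemma integrableOn_and_integral_beta {a b : ℝ} (ha : 0 < a) (hb : 0 < b) :
    IntegrableOn (fun z : ℝ => z ^ (a - 1) * (1 - z) ^ (b - 1)) (Set.Ioo 0 1) ∧
      ∫ z in Set.Ioo (0 : ℝ) 1, z ^ (a - 1) * (1 - z) ^ (b - 1) = ProbabilityTheory.beta a b := by
  have hB := ProbabilityTheory.beta_pos ha hb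
  have hnn : ∀ z, 0 ≤ ProbabilityTheory.betaPDFReal a b z := by
    intro z
    by_cases hz : 0 < z ∧ z < 1
    · exact (ProbabilityTheory.betaPDFReal_pos hz.1 hz.2 ha hb).le
    · rw [ProbabilityTheory.betaPDFReal, if_neg hz]
  have hm := ProbabilityTheory.stronglyMeasurable_betaPDFReal a b
  have hl := ProbabilityTheory.lintegral_betaPDF_eq_one ha hb
  have hint : Integrable (ProbabilityTheory.betaPDFReal a b) := by
    refine ⟨hm.aestronglyMeasurable, ?_⟩
    rw [hasFiniteIntegral_iff_ofReal (.of_forall hnn)]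
    exact hl.trans_lt ENNReal.one_lt_top
  have hI : ∫ z, ProbabilityTheory.betaPDFReal a b z = 1 := by
    rw [integral_eq_lintegral_of_nonneg_ae (.of_forall hnn) hm.aestronglyMeasurable]
    exact (congrArg ENNReal.toReal hl).trans ENNReal.toReal_one
  have heq : Set.EqOn (fun z : ℝ => z ^ (a - 1) * (1 - z) ^ (b - 1))
      (fun z => ProbabilityTheory.beta a b * ProbabilityTheory.betaPDFReal a b z)
      (Set.Ioo 0 1) := by
    intro z hz
    simp only
    rw [ProbabilityTheory.betaPDFReal, if_pos ⟨hz.1, hz.2⟩]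
    field_simp
  refine ⟨((hint.const_mul _).integrableOn).congr_fun heq.symm measurableSet_Ioo, ?_⟩
  rw [setIntegral_congr_fun measurableSet_Ioo heq, integral_const_mul,
    setIntegral_eq_integral_of_forall_compl_eq_zero, hI, mul_one]
  intro z hz
  rw [ProbabilityTheory.betaPDFReal, if_neg (show ¬(0 < z ∧ z < 1) from hz)]

lemma sin_pi_mul_pos {y : ℝ} (hy : y ∈ Set.Ioo (0 : ℝ) 1) : 0 < Real.sin (π * y) :=
  Real.sin_pos_of_pos_of_lt_pi (mul_pos pi_pos hy.1) (by nlinarith [pi_pos, hy.2])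

lemma integrableOn_and_integral_sin_rpow {a : ℝ} (ha : 1 / 2 < a) :
    IntegrableOn (fun y : ℝ => Real.sin (π * y) ^ (2 * a - 2)) (Set.Ioo 0 1) ∧
      ∫ y in Set.Ioo (0 : ℝ) 1, Real.sin (π * y) ^ (2 * a - 2) =
        Real.Gamma (a - 1 / 2) / (√π * Real.Gamma a) := by
  have hb : 0 < a - 1 / 2 := by linarith
  obtain ⟨hint, hval⟩ := integrableOn_and_integral_beta hb hb
  set v : ℝ → ℝ := fun y => (1 - Real.cos (π * y)) / 2 with hv
  have hd : ∀ y ∈ Set.Ioo (0 : ℝ) 1,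
      HasDerivWithinAt v (π / 2 * Real.sin (π * y)) (Set.Ioo 0 1) y := by
    intro y _
    have h := ((((hasDerivAt_id y).const_mul π).cos).const_sub 1).div_const 2
    refine (h.congr_deriv ?_).hasDerivWithinAt
    simp
    ring
  have hmem : ∀ y ∈ Set.Ioo (0 : ℝ) 1, π * y ∈ Set.Icc 0 π := fun y hy =>
    ⟨by have := hy.1; positivity, by nlinarith [pi_pos, hy.2]⟩
  have hinj : Set.InjOn v (Set.Ioo 0 1) := by
    intro y hy z hz h
    have : Real.cos (π * y) = Real.cos (π * z) := by simp only [hv] at h; linarith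
    exact mul_left_cancel₀ pi_ne_zero (Real.injOn_cos (hmem y hy) (hmem z hz) this)
  have himg : v '' Set.Ioo 0 1 = Set.Ioo 0 1 := by
    ext z
    constructor
    · rintro ⟨y, hy, rfl⟩
      have hs := sin_pi_mul_pos hy
      have h2 := Real.sin_sq_add_cos_sq (π * y)
      constructor <;> simp only [hv] <;> nlinarith
    · intro hz
      have h1 : -1 < 1 - 2 * z := by linarith [hz.2]
      have h2 : 1 - 2 * z < 1 := by linarith [hz.1]
      refine ⟨Real.arccos (1 - 2 * z) / π, ⟨div_pos (Real.arccos_pos.mpr h2) pi_pos, ?_⟩, ?_⟩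
      · rw [div_lt_one pi_pos]
        refine lt_of_le_of_ne (Real.arccos_le_pi _) fun h => ?_
        rw [Real.arccos_eq_pi] at h
        linarith
      · simp only [hv]
        rw [mul_div_cancel₀ _ pi_ne_zero, Real.cos_arccos h1.le h2.le]
        ring
  have hcomp : Set.EqOn (fun y => |π / 2 * Real.sin (π * y)| •
      (v y ^ (a - 1 / 2 - 1) * (1 - v y) ^ (a - 1 / 2 - 1)))
      (fun y => π / 2 * (2 : ℝ) ^ (3 - 2 * a) * Real.sin (π * y) ^ (2 * a - 2))
      (Set.Ioo 0 1) := by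
    intro y hy
    have hs := sin_pi_mul_pos hy
    obtain ⟨hv0, hv1⟩ : v y ∈ Set.Ioo 0 1 := himg ▸ Set.mem_image_of_mem v hy
    have hvv : v y * (1 - v y) = (Real.sin (π * y) * 2⁻¹) ^ (2 : ℝ) := by
      rw [Real.rpow_two, mul_pow, Real.sin_sq]
      simp only [hv]
      ring
    simp only [smul_eq_mul]
    rw [abs_of_pos (by positivity), ← Real.mul_rpow hv0.le (by linarith), hvv,
      ← Real.rpow_mul (by positivity), Real.mul_rpow hs.le (by positivity),
      Real.inv_rpow zero_le_two, ← Real.rpow_neg zero_le_two,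
      show 2 * a - 2 = 2 * (a - 1 / 2 - 1) + 1 by ring, Real.rpow_add_one hs.ne',
      show -(2 * (a - 1 / 2 - 1)) = 3 - 2 * a by ring]
    ring
  have hc : π / 2 * (2 : ℝ) ^ (3 - 2 * a) ≠ 0 := by positivity
  constructor
  · rw [← himg, integrableOn_image_iff_integrableOn_abs_deriv_smul measurableSet_Ioo hd hinj]
      at hint
    have h := (hint.congr_fun hcomp measurableSet_Ioo).const_mul (π / 2 * (2 : ℝ) ^ (3 - 2 * a))⁻¹
    refine IntegrableOn.congr_fun h (fun y _ => ?_) measurableSet_Ioo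
    rw [inv_mul_cancel_left₀ hc]
  · nth_rw 1 [← himg] at hval
    rw [integral_image_eq_integral_abs_deriv_smul measurableSet_Ioo hd hinj,
      setIntegral_congr_fun measurableSet_Ioo hcomp, integral_const_mul] at hval
    apply mul_left_cancel₀ hc
    rw [hval, ProbabilityTheory.beta]
    have hdup := Real.Gamma_mul_Gamma_add_half (a - 1 / 2)
    have hG1 := Real.Gamma_pos_of_pos hb
    have hG2 := Real.Gamma_pos_of_pos (show 0 < a by linarith)
    have hG3 := Real.Gamma_pos_of_pos (show 0 < a - 1 / 2 + (a - 1 / 2) by linarith)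
    rw [sub_add_cancel, two_mul] at hdup
    have hp : (2 : ℝ) ^ (3 - 2 * a) = 2 * 2 ^ (1 - (a - 1 / 2 + (a - 1 / 2))) := by
      rw [show 3 - 2 * a = 1 - (a - 1 / 2 + (a - 1 / 2)) + 1 by ring,
        Real.rpow_add_one two_ne_zero, mul_comm]
    have hpi : √π * √π = π := Real.mul_self_sqrt pi_pos.le
    have hsq : √π ≠ 0 := by positivity
    rw [hp, div_eq_iff hG3.ne', mul_div_assoc', div_mul_eq_mul_div,
      eq_div_iff (mul_ne_zero hsq hG2.ne')]
    linear_combination (Real.Gamma (a - 1 / 2) * √π) * hdup +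
      Real.Gamma (a - 1 / 2) * Real.Gamma (a - 1 / 2 + (a - 1 / 2)) *
        2 ^ (1 - (a - 1 / 2 + (a - 1 / 2))) * hpi

namespace Gegenbauer

lemma integrableOn_sin_rpow_mul {k : ℝ} (hk : 1 / 2 < k) {f : ℝ → ℝ} (hf : Continuous f) :
    IntegrableOn (fun y => Real.sin (π * y) ^ (2 * k - 2) * f y) (Set.Ioo 0 1) := by
  have h := (integrableOn_and_integral_sin_rpow hk).1
  rw [← integrableOn_Icc_iff_integrableOn_Ioo] at h ⊢
  exact h.mul_continuousOn hf.continuousOn isCompact_Icc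

lemma continuous_comp_cos (k : ℝ) (n : ℕ) :
    Continuous fun y : ℝ => gegenbauer k n (Real.cos (π * y)) :=
  (contDiff k n).continuous.comp (by fun_prop)

lemma continuous_cos_mul_comp_cos (k : ℝ) (n : ℕ) :
    Continuous fun y : ℝ => Real.cos (π * y) * gegenbauer k n (Real.cos (π * y)) :=
  Continuous.mul (by fun_prop) (continuous_comp_cos k n)

lemma integral_sin_rpow_mul_succ {k : ℝ} (hk : 1 / 2 < k) (n : ℕ) :
    ∫ y in Set.Ioo (0 : ℝ) 1, Real.sin (π * y) ^ (2 * k - 2) *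
        gegenbauer k (n + 1) (Real.cos (π * y)) =
      ∫ y in Set.Ioo (0 : ℝ) 1, Real.sin (π * y) ^ (2 * k - 2) *
        (Real.cos (π * y) * gegenbauer k n (Real.cos (π * y))) := by
  have hk0 : 0 < k := by linarith
  have hi1 := integrableOn_sin_rpow_mul hk (continuous_comp_cos k (n + 1))
  have hi2 := integrableOn_sin_rpow_mul hk (continuous_cos_mul_comp_cos k n)
  set f' : ℝ → ℝ := fun y => π * (n + 1) * (Real.sin (π * y) ^ (2 * k - 2) *
        gegenbauer k (n + 1) (Real.cos (π * y)) - Real.sin (π * y) ^ (2 * k - 2) *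
        (Real.cos (π * y) * gegenbauer k n (Real.cos (π * y)))) with hf'
  have hd : ∀ y ∈ Set.Ioo (0 : ℝ) 1, HasDerivAt (fun y => Real.sin (π * y) ^ (2 * k - 1) *
      gegenbauer k n (Real.cos (π * y))) (f' y) y := by
    intro y hy
    have hs := sin_pi_mul_pos hy
    have hl : HasDerivAt (fun y : ℝ => π * y) π y := by
      simpa using (hasDerivAt_id y).const_mul π
    have h1 := hl.sin.rpow_const (p := 2 * k - 1) (.inl hs.ne')
    have h2 := (hasDerivAt k n (Real.cos (π * y))).comp y hl.cos
    refine (h1.mul h2).congr_deriv ?_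
    have hp : Real.sin (π * y) ^ (2 * k - 1) =
        Real.sin (π * y) ^ (2 * k - 2) * Real.sin (π * y) := by
      rw [← Real.rpow_add_one hs.ne']
      congr 1; ring
    have hq : 2 * k - 1 - 1 = 2 * k - 2 := by ring
    have e := one_sub_sq_mul_deriv hk0 n (Real.cos (π * y))
    rw [← Real.sin_sq] at e
    simp only [hf', hp, hq, Function.comp]
    linear_combination (-π * Real.sin (π * y) ^ (2 * k - 2)) * e
  have hint : IntegrableOn f' (Set.Ioo 0 1) := (hi1.sub hi2).const_mul _
  have hcont : ContinuousOn (fun y : ℝ => Real.sin (π * y) ^ (2 * k - 1) *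
      gegenbauer k n (Real.cos (π * y))) (Set.Icc 0 1) :=
    ContinuousOn.mul (ContinuousOn.rpow_const (by fun_prop) fun y _ => .inr (by linarith))
      (continuous_comp_cos k n).continuousOn
  have h := intervalIntegral.integral_eq_sub_of_hasDerivAt_of_le zero_le_one (f' := f') hcont hd
    ((intervalIntegrable_iff_integrableOn_Ioo_of_le zero_le_one).mpr hint)
  have h0 : 2 * k - 1 ≠ 0 := by linarith
  rw [intervalIntegral.integral_of_le zero_le_one, integral_Ioc_eq_integral_Ioo,
    integral_const_mul, integral_sub hi1 hi2] at h
  simp only [mul_one, mul_zero, sin_pi, sin_zero, Real.zero_rpow h0, zero_mul, sub_zero] at h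
  have hn : π * ((n : ℝ) + 1) ≠ 0 := by positivity
  exact sub_eq_zero.mp ((mul_eq_zero.mp h).resolve_left hn)

lemma integral_sin_rpow_mul {k : ℝ} (hk : 1 / 2 < k) (n : ℕ) :
    ∫ y in Set.Ioo (0 : ℝ) 1, Real.sin (π * y) ^ (2 * k - 2) *
        gegenbauer k n (Real.cos (π * y)) =
      if Even n then Real.Gamma (k - 1 / 2) / (√π * Real.Gamma k) else 0 := by
  have hk0 : 0 < k := by linarith
  induction n using Nat.twoStepInduction with
  | zero => simpa [zero_eq hk0] using (integrableOn_and_integral_sin_rpow hk).2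
  | one =>
    have h := integral_sin_rpow_mul_succ hk 0
    simp only [zero_add, zero_eq hk0, mul_one, one_eq hk0] at h
    have h2 : ∫ y in Set.Ioo (0 : ℝ) 1, Real.sin (π * y) ^ (2 * k - 2) *
        (2 * k * Real.cos (π * y)) = 2 * k * ∫ y in Set.Ioo (0 : ℝ) 1,
          Real.sin (π * y) ^ (2 * k - 2) * Real.cos (π * y) := by
      rw [← integral_const_mul]
      congr 1 with y
      ring
    rw [h2] at h
    simp only [one_eq hk0, h2, Nat.not_even_one, if_false]
    have : (2 * k - 1) * ∫ y in Set.Ioo (0 : ℝ) 1,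
        Real.sin (π * y) ^ (2 * k - 2) * Real.cos (π * y) = 0 := by linarith
    rw [(mul_eq_zero.mp this).resolve_left (by linarith), mul_zero]
  | more n ih _ =>
    simp only [Nat.even_add, even_two, iff_true]
    rw [← ih]
    have h := integral_sin_rpow_mul_succ hk (n + 1)
    have hi0 := integrableOn_sin_rpow_mul hk (continuous_comp_cos k n)
    have hi1 := integrableOn_sin_rpow_mul hk (continuous_cos_mul_comp_cos k (n + 1))
    have hr : (n + 2) * ∫ y in Set.Ioo (0 : ℝ) 1, Real.sin (π * y) ^ (2 * k - 2) *
        gegenbauer k (n + 2) (Real.cos (π * y)) =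
        2 * (n + 1 + k) * (∫ y in Set.Ioo (0 : ℝ) 1, Real.sin (π * y) ^ (2 * k - 2) *
          (Real.cos (π * y) * gegenbauer k (n + 1) (Real.cos (π * y)))) -
        (n + 2 * k) * ∫ y in Set.Ioo (0 : ℝ) 1, Real.sin (π * y) ^ (2 * k - 2) *
          gegenbauer k n (Real.cos (π * y)) := by
      simp only [← integral_const_mul]
      rw [← integral_sub (hi1.const_mul _) (hi0.const_mul _)]
      congr 1 with y
      linear_combination Real.sin (π * y) ^ (2 * k - 2) * recurrence hk0 n (Real.cos (π * y))
    rw [← h] at hr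
    have hn : (n : ℝ) + 2 * k ≠ 0 := by positivity
    apply mul_left_cancel₀ hn
    linarith

end Gegenbauer

lemma lambdaAff_zero (k : ℝ) : lambdaAff k 0 = 0 := by simp [lambdaAff]

lemma sq_le_lambdaAff {k : ℝ} (hk : 0 < k) (n : ℕ) : (n : ℝ) ^ 2 ≤ lambdaAff k n := by
  rw [lambdaAff]
  have h1 : (1 : ℝ) ≤ π ^ 2 / 2 := by nlinarith [pi_gt_three]
  have h2 : (n : ℝ) ^ 2 ≤ n * (n + 2 * k) := by
    nlinarith [mul_nonneg n.cast_nonneg hk.le]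
  calc (n : ℝ) ^ 2 ≤ 1 * (n * (n + 2 * k)) := by rwa [one_mul]
    _ ≤ π ^ 2 / 2 * (n * (n + 2 * k)) := by gcongr
    _ = π ^ 2 / 2 * n * (n + 2 * k) := by ring

lemma lambdaAff_pos {k : ℝ} (hk : 0 < k) {n : ℕ} (hn : 0 < n) : 0 < lambdaAff k n :=
  lt_of_lt_of_le (by positivity) (sq_le_lambdaAff hk n)

lemma integral_Ioo_exp_neg_mul {c t : ℝ} (hc : c ≠ 0) (ht : 0 ≤ t) :
    ∫ s in Set.Ioo 0 t, Real.exp (-c * s) = 1 / c * (1 - Real.exp (-c * t)) := by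
  rw [← integral_Ioc_eq_integral_Ioo, ← intervalIntegral.integral_of_le ht,
    intervalIntegral.integral_comp_mul_left (fun u => Real.exp u) (neg_ne_zero.mpr hc),
    integral_exp, mul_zero, Real.exp_zero, smul_eq_mul]
  field_simp
  ring

lemma integrableOn_exp_mul (c t : ℝ) :
    IntegrableOn (fun s => Real.exp (c * s)) (Set.Ioo 0 t) :=
  (Continuous.integrableOn_Icc (by fun_prop)).mono_set Set.Ioo_subset_Icc_self

lemma integral_exp_neg_lambdaAff_le {k t : ℝ} (hk : 0 < k) (ht : 0 ≤ t) {n : ℕ} (hn : 0 < n) :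
    ∫ s in Set.Ioo 0 t, Real.exp (-(lambdaAff k n) * s) ≤ (n : ℝ) ^ (-2 : ℝ) := by
  have hl := lambdaAff_pos hk hn
  rw [integral_Ioo_exp_neg_mul hl.ne' ht, Real.rpow_neg n.cast_nonneg, Real.rpow_two, one_div]
  calc (lambdaAff k n)⁻¹ * (1 - Real.exp (-(lambdaAff k n) * t)) ≤ (lambdaAff k n)⁻¹ * 1 := by
        gcongr
        linarith [Real.exp_pos (-(lambdaAff k n) * t)]
    _ ≤ ((n : ℝ) ^ 2)⁻¹ := by
        rw [mul_one]
        exact inv_anti₀ (by positivity) (sq_le_lambdaAff hk n)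

namespace Gegenbauer

lemma abs_cos_pi_mul_lt_one {y : ℝ} (hy : y ∈ Set.Ioo (0 : ℝ) 1) : |Real.cos (π * y)| < 1 := by
  rw [← sq_lt_one_iff_abs_lt_one, Real.cos_sq']
  have := sin_pi_mul_pos hy
  nlinarith

lemma exists_integral_norm_le {k σ : ℝ} (hσ : 1 / 2 < σ) (hσk : σ ≤ k) :
    ∃ C > 0, ∀ n : ℕ, 0 < n → ∫ y in Set.Ioo (0 : ℝ) 1,
      ‖Real.sin (π * y) ^ (2 * k - 2) * gegenbauer k n (Real.cos (π * y))‖ ≤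
        C * (n : ℝ) ^ (k - 1 + σ) := by
  have hk : 1 / 2 < k := hσ.trans_le hσk
  obtain ⟨C, hC, hCb⟩ := exists_abs_le_interpolated (k := k) (σ := σ) (by linarith)
    (by linarith) hσk
  obtain ⟨hint, hval⟩ := integrableOn_and_integral_sin_rpow hσ
  set B := ∫ y in Set.Ioo (0 : ℝ) 1, Real.sin (π * y) ^ (2 * σ - 2)
  have hB : 0 < B := by
    have := Real.Gamma_pos_of_pos (show 0 < σ - 1 / 2 by linarith)
    have := Real.Gamma_pos_of_pos (show 0 < σ by linarith)
    rw [hval]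
    positivity
  refine ⟨C * B, by positivity, fun n hn => ?_⟩
  calc ∫ y in Set.Ioo (0 : ℝ) 1,
        ‖Real.sin (π * y) ^ (2 * k - 2) * gegenbauer k n (Real.cos (π * y))‖
      ≤ ∫ y in Set.Ioo (0 : ℝ) 1, C * (n : ℝ) ^ (k - 1 + σ) * Real.sin (π * y) ^ (2 * σ - 2) := by
        refine setIntegral_mono_on
          (integrableOn_sin_rpow_mul hk (continuous_comp_cos k n)).norm
          (hint.const_mul _) measurableSet_Ioo fun y hy => ?_
        have hs := sin_pi_mul_pos hy
        rw [norm_mul, Real.norm_of_nonneg (by positivity), Real.norm_eq_abs]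
        have hb := hCb n hn _ (abs_cos_pi_mul_lt_one hy)
        rw [← Real.sin_sq, ← Real.rpow_two, ← Real.rpow_mul hs.le] at hb
        calc _ ≤ Real.sin (π * y) ^ (2 * k - 2) *
              (C * ((n : ℝ) ^ (k - 1 + σ) * Real.sin (π * y) ^ (2 * (σ - k)))) := by gcongr
          _ = C * (n : ℝ) ^ (k - 1 + σ) *
              (Real.sin (π * y) ^ (2 * k - 2) * Real.sin (π * y) ^ (2 * (σ - k))) := by ring
          _ = _ := by
            rw [← Real.rpow_add hs]
            congr 2; ring
    _ = C * B * (n : ℝ) ^ (k - 1 + σ) := by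
        rw [integral_const_mul]
        ring

/-- The `n`-th term of the series of `sin (π y) ^ (-2) * qDensity k s x y`, as a function of
`(s, y)`. -/
noncomputable def densityTerm (k x : ℝ) (n : ℕ) (p : ℝ × ℝ) : ℝ :=
  Real.exp (-(lambdaAff k n) * p.1) * (omegaAff k n * gegenbauer k n (Real.cos (π * x)) *
    (Real.sin (π * p.2) ^ (2 * k - 2) * gegenbauer k n (Real.cos (π * p.2))))

lemma sin_rpow_mul_qDensity (k s x : ℝ) {y : ℝ} (hy : y ∈ Set.Ioo (0 : ℝ) 1) :
    Real.sin (π * y) ^ (-2 : ℝ) * qDensity k s x y = ∑' n, densityTerm k x n (s, y) := by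
  have hs := sin_pi_mul_pos hy
  rw [qDensity, ← tsum_mul_left]
  refine tsum_congr fun n => ?_
  rw [densityTerm, show 2 * k - 2 = -2 + 2 * k by ring, Real.rpow_add hs]
  ring

lemma integrable_densityTerm {k : ℝ} (hk : 1 / 2 < k) (x t : ℝ) (n : ℕ) :
    Integrable (densityTerm k x n)
      ((volume.restrict (Set.Ioo 0 t)).prod (volume.restrict (Set.Ioo 0 1))) :=
  Integrable.mul_prod (integrableOn_exp_mul _ t)
    ((integrableOn_sin_rpow_mul hk (continuous_comp_cos k n)).const_mul _)

lemma integral_densityTerm (k x t : ℝ) (n : ℕ) :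
    ∫ p, densityTerm k x n p
        ∂(volume.restrict (Set.Ioo 0 t)).prod (volume.restrict (Set.Ioo 0 1)) =
      (∫ s in Set.Ioo 0 t, Real.exp (-(lambdaAff k n) * s)) *
        (omegaAff k n * gegenbauer k n (Real.cos (π * x)) *
          ∫ y in Set.Ioo (0 : ℝ) 1,
            Real.sin (π * y) ^ (2 * k - 2) * gegenbauer k n (Real.cos (π * y))) := by
  rw [← integral_const_mul, ← integral_prod_mul]
  rfl

lemma integral_norm_densityTerm (k x t : ℝ) (n : ℕ) :
    ∫ p, ‖densityTerm k x n p‖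
        ∂(volume.restrict (Set.Ioo 0 t)).prod (volume.restrict (Set.Ioo 0 1)) =
      (∫ s in Set.Ioo 0 t, Real.exp (-(lambdaAff k n) * s)) *
        (|omegaAff k n * gegenbauer k n (Real.cos (π * x))| *
          ∫ y in Set.Ioo (0 : ℝ) 1,
            ‖Real.sin (π * y) ^ (2 * k - 2) * gegenbauer k n (Real.cos (π * y))‖) := by
  rw [← integral_const_mul, ← integral_prod_mul]
  simp only [densityTerm, norm_mul, Real.norm_eq_abs, Real.abs_exp, abs_mul]

lemma summable_integral_norm_densityTerm {k x t : ℝ} (hk : 1 / 2 < k)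
    (hx : x ∈ Set.Ioo (0 : ℝ) 1) (ht : 0 ≤ t) :
    Summable fun n => ∫ p, ‖densityTerm k x n p‖
      ∂(volume.restrict (Set.Ioo 0 t)).prod (volume.restrict (Set.Ioo 0 1)) := by
  have hk0 : 0 < k := by linarith
  obtain ⟨σ, hσ, hσk, hσ1⟩ : ∃ σ : ℝ, 1 / 2 < σ ∧ σ ≤ k ∧ σ < 1 :=
    ⟨min k (3 / 4), lt_min hk (by norm_num), min_le_left _ _,
      (min_le_right _ _).trans_lt (by norm_num)⟩
  obtain ⟨A, hA, hAb⟩ := exists_omegaAff_le hk0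
  obtain ⟨B, hB, hBb⟩ := exists_abs_le_interpolated hk0 le_rfl hk0.le
  obtain ⟨C, hC, hCb⟩ := exists_integral_norm_le hσ hσk
  set d := (1 - Real.cos (π * x) ^ 2) ^ (0 - k)
  have hd : 0 ≤ d := Real.rpow_nonneg (by rw [← Real.sin_sq]; positivity) _
  refine .of_norm_bounded_eventually_nat (g := fun n => A * B * d * C * (n : ℝ) ^ (σ - 2))
    ((Real.summable_nat_rpow.mpr (by linarith)).mul_left _) ?_
  filter_upwards [eventually_gt_atTop 0] with n hn
  have hn' : (0 : ℝ) < n := by positivity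
  have hI : 0 ≤ ∫ y in Set.Ioo (0 : ℝ) 1,
      ‖Real.sin (π * y) ^ (2 * k - 2) * gegenbauer k n (Real.cos (π * y))‖ :=
    integral_nonneg fun y => norm_nonneg _
  have hω := omegaAff_pos hk0 n
  rw [Real.norm_of_nonneg (integral_nonneg fun p => norm_nonneg _), integral_norm_densityTerm,
    abs_mul, abs_of_pos hω]
  have hBn := hBb n hn _ (abs_cos_pi_mul_lt_one hx)
  calc _ ≤ (n : ℝ) ^ (-2 : ℝ) * (A * (n : ℝ) ^ (2 - 2 * k) * (B * ((n : ℝ) ^ (k - 1 + 0) * d)) *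
        (C * (n : ℝ) ^ (k - 1 + σ))) :=
        mul_le_mul (integral_exp_neg_lambdaAff_le hk0 ht hn)
          (mul_le_mul (mul_le_mul (hAb n hn) hBn (abs_nonneg _) (by positivity)) (hCb n hn) hI
            (by positivity)) (by positivity) (by positivity)
    _ = A * B * d * C * ((n : ℝ) ^ (-2 : ℝ) * (n : ℝ) ^ (2 - 2 * k) * (n : ℝ) ^ (k - 1 + 0) *
        (n : ℝ) ^ (k - 1 + σ)) := by ring
    _ = _ := by
        rw [← Real.rpow_add hn', ← Real.rpow_add hn', ← Real.rpow_add hn']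
        congr 2; ring

end Gegenbauer

end Asymptotics

theorem expected_inverse_sin_sq_integral (k : ℝ) (hk : 1 / 2 < k)
    (x : ℝ) (hx : x ∈ Set.Ioo (0 : ℝ) 1) (t : ℝ) (ht : 0 < t) :
    IntegrableOn
        (fun p : ℝ × ℝ => Real.sin (Real.pi * p.2) ^ (-2 : ℝ) * qDensity k p.1 x p.2)
        (Set.Ioo 0 t ×ˢ Set.Ioo (0 : ℝ) 1) ∧
    Summable (fun n : ℕ =>
      |1 / lambdaAff k (2 * (n + 1)) * (1 - Real.exp (-(lambdaAff k (2 * (n + 1))) * t)) *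
        omegaAff k (2 * (n + 1)) * gegenbauer k (2 * (n + 1)) (Real.cos (Real.pi * x))|) ∧
    (∫ s in Set.Ioo (0 : ℝ) t, ∫ y in Set.Ioo (0 : ℝ) 1,
        Real.sin (Real.pi * y) ^ (-2 : ℝ) * qDensity k s x y)
      = Real.Gamma (k - 1 / 2) / (Real.sqrt Real.pi * Real.Gamma k) *
          (t * omegaAff k 0 +
            ∑' n : ℕ,
              1 / lambdaAff k (2 * (n + 1)) *
                (1 - Real.exp (-(lambdaAff k (2 * (n + 1))) * t)) *
                  omegaAff k (2 * (n + 1)) *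
                    gegenbauer k (2 * (n + 1)) (Real.cos (Real.pi * x))) := by
  have hk0 : 0 < k := by linarith
  set J := Real.Gamma (k - 1 / 2) / (√π * Real.Gamma k) with hJ
  have hJ0 : 0 < J := by
    have := Real.Gamma_pos_of_pos (show 0 < k - 1 / 2 by linarith)
    have := Real.Gamma_pos_of_pos hk0
    positivity
  set μ := (volume.restrict (Set.Ioo 0 t)).prod (volume.restrict (Set.Ioo (0 : ℝ) 1)) with hμ
  have hμ' : (volume : Measure (ℝ × ℝ)).restrict (Set.Ioo 0 t ×ˢ Set.Ioo (0 : ℝ) 1) = μ := by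
    rw [Measure.volume_eq_prod, ← Measure.prod_restrict]
  have hint := Gegenbauer.integrable_densityTerm hk x t
  have hsum := Gegenbauer.summable_integral_norm_densityTerm hk hx ht.le
  have heq : Set.EqOn
      (fun p : ℝ × ℝ => Real.sin (π * p.2) ^ (-2 : ℝ) * qDensity k p.1 x p.2)
      (fun p => ∑' n, Gegenbauer.densityTerm k x n p) (Set.Ioo 0 t ×ˢ Set.Ioo (0 : ℝ) 1) :=
    fun p hp => Gegenbauer.sin_rpow_mul_qDensity k p.1 x hp.2
  have hmeas : MeasurableSet (Set.Ioo 0 t ×ˢ Set.Ioo (0 : ℝ) 1) :=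
    measurableSet_Ioo.prod measurableSet_Ioo
  have hmain : IntegrableOn
      (fun p : ℝ × ℝ => Real.sin (π * p.2) ^ (-2 : ℝ) * qDensity k p.1 x p.2)
      (Set.Ioo 0 t ×ˢ Set.Ioo (0 : ℝ) 1) := by
    refine IntegrableOn.congr_fun ?_ heq.symm hmeas
    rw [IntegrableOn, hμ']
    exact integrable_tsum_of_summable_integral_norm hint hsum
  have hHas := hasSum_integral_of_summable_integral_norm hint hsum
  have hval : ∫ p, ∑' n, Gegenbauer.densityTerm k x n p ∂μ = ∫ s in Set.Ioo 0 t,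
      ∫ y in Set.Ioo (0 : ℝ) 1, Real.sin (π * y) ^ (-2 : ℝ) * qDensity k s x y := by
    rw [← hμ', ← setIntegral_congr_fun hmeas heq, Measure.volume_eq_prod,
      setIntegral_prod _ hmain]
  rw [hval] at hHas
  have hodd : ∀ n ∉ Set.range (fun m : ℕ => 2 * m),
      ∫ p, Gegenbauer.densityTerm k x n p ∂μ = 0 := by
    intro n hn
    have hn' : ¬Even n := fun ⟨m, hm⟩ => hn ⟨m, by simp only; omega⟩
    rw [Gegenbauer.integral_densityTerm, Gegenbauer.integral_sin_rpow_mul hk, if_neg hn',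
      mul_zero, mul_zero]
  have hinj : Function.Injective fun m : ℕ => 2 * m := mul_right_injective₀ two_ne_zero
  rw [← hinj.hasSum_iff hodd, ← hasSum_nat_add_iff' 1] at hHas
  have hterm (n : ℕ) : ∫ p, Gegenbauer.densityTerm k x (2 * (n + 1)) p ∂μ =
      J * (1 / lambdaAff k (2 * (n + 1)) * (1 - Real.exp (-(lambdaAff k (2 * (n + 1))) * t)) *
        omegaAff k (2 * (n + 1)) * gegenbauer k (2 * (n + 1)) (Real.cos (π * x))) := by
    rw [Gegenbauer.integral_densityTerm, Gegenbauer.integral_sin_rpow_mul hk,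
      if_pos (even_two_mul _),
      integral_Ioo_exp_neg_mul (lambdaAff_pos hk0 (by positivity)).ne' ht.le]
    ring
  have hzero : ∫ p, Gegenbauer.densityTerm k x (2 * 0) p ∂μ = J * (t * omegaAff k 0) := by
    rw [Gegenbauer.integral_densityTerm, Gegenbauer.integral_sin_rpow_mul hk,
      if_pos (even_two_mul _), mul_zero, lambdaAff_zero, Gegenbauer.zero_eq hk0, ← hJ]
    simp [ht.le]
    ring
  simp only [Function.comp_def, Finset.sum_range_one, hterm, hzero] at hHas
  have hS := (summable_mul_left_iff hJ0.ne').mp hHas.summable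
  refine ⟨hmain, hS.abs, ?_⟩
  rw [mul_add, ← tsum_mul_left, hHas.tsum_eq]
  ring
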